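/- Let n+s be odd with 0 ≤ s ≤ n−3 and f ∈ WRP with sign ε and dual g. Consider the code C_{D_f} with defining set D_f = {x ∈ F_q^* : f(x) = 0}. Then: (a) the length is #D_f = p^{n−1} − 1; (b) the map β ↦ c_β is injective, so the code has dimension n; (c) the nonzero weights and their multiplicities are: wt(c_β) = (p−1)p^{n−2} for exactly p^n + p^{n−s−1} − p^{n−s} − 1 values of β ∈ F_q^*; wt(c_β) = (p−1)(p^{n−2} − ε√(p*)^{n+s−3}) for exactly ((p−1)/2)(p^{n−s−1} + ε η_0(−1)^n √(p*)^{n−s−1}) values of β; and wt(c_β) = (p−1)(p^{n−2} + ε√(p*)^{n+s−3}) for exactly ((p−1)/2)(p^{n−s−1} − ε η_0(−1)^n √(p*)^{n−s−1}) values of β. In particular C_{D_f} is a three-weight [p^{n−1}−1, n, (p−1)(p^{n−2} − p^{(n+s−3)/2})]_p code. -/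

import Mathlib

open scoped BigOperators Classical

noncomputable section

/-- `ξ_p^j` for `j : ZMod p`, where `ξ_p = exp(2πi/p)` and the exponent `j`
is lifted to a natural number. -/
def ep (p : ℕ) (j : ZMod p) : ℂ :=
  Complex.exp (2 * Real.pi * Complex.I * (j.val : ℂ) / (p : ℂ))

/-- `√(p*)`: equal to `√p` if `p ≡ 1 (mod 4)` and to `i√p` if `p ≡ 3 (mod 4)`. -/
def sqrtPStar (p : ℕ) : ℂ :=
  if p % 4 = 1 then ((Real.sqrt p : ℝ) : ℂ) else Complex.I * ((Real.sqrt p : ℝ) : ℂ)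

/-- The quadratic character `η₀` of `F_p` (extended by `η₀(0) = 0`), with values in `ℂ`. -/
def eta0 (p : ℕ) [Fact p.Prime] (j : ZMod p) : ℂ :=
  ((quadraticChar (ZMod p) j : ℤ) : ℂ)

/-- The Walsh transform of `f : F_q → F_p`. -/
def walsh (p : ℕ) {F : Type*} [Field F] [Fintype F] [Algebra (ZMod p) F]
    (f : F → ZMod p) (β : F) : ℂ :=
  ∑ x : F, ep p (f x - Algebra.trace (ZMod p) F (β * x))

/-- `f` is weakly regular `s`-plateaued with sign `ε` and dual `g`:
`W_f(β) = ε √(p*)^{n+s} ξ_p^{g(β)}` on the Walsh support, `W_f(β) = 0` off it,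
and `g` vanishes off the Walsh support. -/
def IsWeaklyRegularPlateaued (p n s : ℕ) {F : Type*} [Field F] [Fintype F]
    [Algebra (ZMod p) F] (f : F → ZMod p) (ε : ℂ) (g : F → ZMod p) : Prop :=
  (ε = 1 ∨ ε = -1) ∧
  (∀ β : F, walsh p f β ≠ 0 →
      walsh p f β = ε * sqrtPStar p ^ (n + s) * ep p (g β)) ∧
  (∀ β : F, walsh p f β = 0 → g β = 0)

/-- `f` lies in the class `WRP`: weakly regular `s`-plateaued with sign `ε` and dual `g`,
unbalanced, `f(0) = 0`, and `f(ax) = a^h f(x)` for some positive even `h` with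
`gcd(h-1, p-1) = 1`. -/
def IsWRP (p n s : ℕ) {F : Type*} [Field F] [Fintype F]
    [Algebra (ZMod p) F] (f : F → ZMod p) (ε : ℂ) (g : F → ZMod p) : Prop :=
  IsWeaklyRegularPlateaued p n s f ε g ∧
  walsh p f 0 ≠ 0 ∧
  f 0 = 0 ∧
  ∃ h : ℕ, 0 < h ∧ Even h ∧ Nat.gcd (h - 1) (p - 1) = 1 ∧
    ∀ (a : (ZMod p)ˣ) (x : F),
      f (algebraMap (ZMod p) F (a : ZMod p) * x) = (a : ZMod p) ^ h * f x

/-- The defining set `D_f = {x ∈ F_q^* : f(x) = 0}`. -/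
def Dzero (p : ℕ) {F : Type*} [Field F] [Fintype F] [Algebra (ZMod p) F]
    (f : F → ZMod p) : Finset F :=
  Finset.univ.filter fun x => x ≠ 0 ∧ f x = 0

/-- The defining set `D_{f,sq} = {x ∈ F_q : f(x) ∈ SQ}`. -/
def Dsq (p : ℕ) {F : Type*} [Field F] [Fintype F] [Algebra (ZMod p) F]
    (f : F → ZMod p) : Finset F :=
  Finset.univ.filter fun x => f x ≠ 0 ∧ IsSquare (f x)

/-- The defining set `D_{f,nsq} = {x ∈ F_q : f(x) ∈ NSQ}`. -/
def Dnsq (p : ℕ) {F : Type*} [Field F] [Fintype F] [Algebra (ZMod p) F]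
    (f : F → ZMod p) : Finset F :=
  Finset.univ.filter fun x => f x ≠ 0 ∧ ¬ IsSquare (f x)

/-- The codeword `c_β = (Tr(βd))_{d ∈ D}` of the code `C_D`. -/
def cword (p : ℕ) {F : Type*} [Field F] [Fintype F] [Algebra (ZMod p) F]
    (D : Finset F) (β : F) : D → ZMod p :=
  fun d => Algebra.trace (ZMod p) F (β * (d : F))

/-- The Hamming weight of the codeword `c_β` of the code `C_D`. -/
def wtOn (p : ℕ) {F : Type*} [Field F] [Fintype F] [Algebra (ZMod p) F]
    (D : Finset F) (β : F) : ℕ :=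
  (D.filter fun d => Algebra.trace (ZMod p) F (β * d) ≠ 0).card

section AdditiveCharacter

variable (p : ℕ)

lemma ep_eq_pow (j : ZMod p) :
    ep p j = Complex.exp (2 * Real.pi * Complex.I / p) ^ j.val := by
  rw [ep, ← Complex.exp_nat_mul]
  congr 1
  ring

variable [Fact p.Prime]

lemma ep_eq_stdAddChar (j : ZMod p) : ep p j = ZMod.stdAddChar j := by
  have h := ZMod.stdAddChar_coe (N := p) (j.val : ℤ)
  rw [Int.cast_natCast, ZMod.natCast_zmod_val] at h
  rw [h, ep]
  simp

lemma ep_zero : ep p 0 = 1 := by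
  simp [ep]

lemma ep_add (i j : ZMod p) : ep p (i + j) = ep p i * ep p j := by
  simp only [ep_eq_stdAddChar, AddChar.map_add_eq_mul]

lemma conj_ep (j : ZMod p) : (starRingEnd ℂ) (ep p j) = ep p (-j) := by
  rw [ep_eq_stdAddChar, ep_eq_stdAddChar, AddChar.map_neg_eq_conj]

/-- The only integral linear relations between the `p`-th roots of unity are the multiples of
the relation saying that their sum vanishes. -/
lemma mul_coeff_eq_sum_of_sum_ep_eq_zero (a : ZMod p → ℤ)
    (h : ∑ j, (a j : ℂ) * ep p j = 0) (i : ZMod p) : (p : ℤ) * a i = ∑ j, a j := by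
  have hp := (Fact.out : p.Prime)
  set ζ := Complex.exp (2 * Real.pi * Complex.I / p) with hζ
  have hprim : IsPrimitiveRoot ζ p := Complex.isPrimitiveRoot_exp p hp.ne_zero
  set P : Polynomial ℚ := ∑ j : ZMod p, Polynomial.monomial j.val (a j : ℚ) with hP
  have hcoeff (k : ZMod p) : P.coeff k.val = a k := by
    simp only [hP, Polynomial.finsetSum_coeff, Polynomial.coeff_monomial]
    rw [Finset.sum_eq_single k]
    · simp
    · intro b _ hb
      exact if_neg fun e => hb (ZMod.val_injective p e)
    · simp
  have hroot : Polynomial.aeval ζ P = 0 := by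
    simp only [hP, map_sum, Polynomial.aeval_monomial]
    rw [← h]
    refine Finset.sum_congr rfl fun j _ => ?_
    rw [ep_eq_pow, ← hζ]
    simp
  have hdvd : Polynomial.cyclotomic p ℚ ∣ P := by
    rw [Polynomial.cyclotomic_eq_minpoly_rat hprim hp.pos]
    exact minpoly.dvd ℚ ζ hroot
  have hconst : ∃ c : ℚ, ∀ k : ZMod p, (a k : ℚ) = c := by
    obtain ⟨Q, hQ⟩ := hdvd
    by_cases hQ0 : Q = 0
    · refine ⟨0, fun k => ?_⟩
      rw [← hcoeff, hQ, hQ0]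
      simp
    have hdeg : P.natDegree ≤ p - 1 := by
      refine Polynomial.natDegree_sum_le_of_forall_le _ _ fun j _ => ?_
      refine (Polynomial.natDegree_monomial_le _).trans ?_
      have := ZMod.val_lt j
      omega
    have hQdeg : Q.natDegree = 0 := by
      have := Polynomial.natDegree_mul (Polynomial.cyclotomic_ne_zero p ℚ) hQ0
      rw [← hQ, Polynomial.natDegree_cyclotomic, Nat.totient_prime hp] at this
      omega
    obtain ⟨c, rfl⟩ := Polynomial.natDegree_eq_zero.mp hQdeg
    refine ⟨c, fun k => ?_⟩
    rw [← hcoeff, hQ, Polynomial.coeff_mul_C, Polynomial.cyclotomic_prime,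
      Polynomial.finsetSum_coeff]
    simp only [Polynomial.coeff_X_pow]
    rw [Finset.sum_ite_eq, if_pos (Finset.mem_range.mpr (ZMod.val_lt k)), one_mul]
  obtain ⟨c, hc⟩ := hconst
  have hci (k : ZMod p) : a k = a i := by
    have := (hc k).trans (hc i).symm
    exact_mod_cast this
  simp [hci, ZMod.card]

lemma sqrtPStar_sq (hp : p ≠ 2) :
    sqrtPStar p ^ 2 = ((quadraticChar (ZMod p) (-1) : ℤ) : ℂ) * p := by
  have hodd : p % 2 = 1 := (Fact.out : p.Prime).eq_two_or_odd.resolve_left hp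
  have hchar : ringChar (ZMod p) ≠ 2 := by rwa [ZMod.ringChar_zmod_n]
  have hsq : ((Real.sqrt p : ℝ) : ℂ) ^ 2 = p := by
    rw [← Complex.ofReal_pow, Real.sq_sqrt (Nat.cast_nonneg p), Complex.ofReal_natCast]
  rw [quadraticChar_neg_one hchar, ZMod.card]
  rcases (by omega : p % 4 = 1 ∨ p % 4 = 3) with h | h
  · rw [ZMod.χ₄_nat_one_mod_four h, sqrtPStar, if_pos h, hsq]
    simp
  · rw [ZMod.χ₄_nat_three_mod_four h, sqrtPStar, if_neg (by omega), mul_pow, hsq]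
    simp

/-- Up to a global sign, the quadratic character has Gauss sum `√(p*)`. -/
lemma exists_quadratic_sum_ep_eq_sqrtPStar (hp : p ≠ 2) :
    ∃ τ : ZMod p → ℤ, τ 0 = 0 ∧ (∀ j, j ≠ 0 → τ j = 1 ∨ τ j = -1) ∧
      (∀ j, τ (-j) = quadraticChar (ZMod p) (-1) * τ j) ∧ ∑ j, τ j = 0 ∧
      ∑ j, (τ j : ℂ) * ep p j = sqrtPStar p := by
  have hchar : ringChar (ZMod p) ≠ 2 := by rwa [ZMod.ringChar_zmod_n]
  set χ : MulChar (ZMod p) ℂ := (quadraticChar (ZMod p)).ringHomComp (Int.castRingHom ℂ) with hχ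
  have hχ1 : χ ≠ 1 :=
    (MulChar.ringHomComp_ne_one_iff (RingHom.injective_int _)).mpr (quadraticChar_ne_one hchar)
  have hχ2 : χ.IsQuadratic := (quadraticChar_isQuadratic (ZMod p)).comp _
  have hG := gaussSum_sq hχ1 hχ2 (ZMod.isPrimitive_stdAddChar p)
  have hsq : gaussSum χ (ZMod.stdAddChar (N := p)) ^ 2 = sqrtPStar p ^ 2 := by
    rw [hG, sqrtPStar_sq p hp, ZMod.card]
    rfl
  have hsum : gaussSum χ (ZMod.stdAddChar (N := p)) =
      ∑ j, ((quadraticChar (ZMod p) j : ℤ) : ℂ) * ep p j := by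
    simp only [ep_eq_stdAddChar]
    rfl
  obtain ⟨δ, hδ, hδG⟩ : ∃ δ : ℤ, (δ = 1 ∨ δ = -1) ∧
      sqrtPStar p = δ * gaussSum χ (ZMod.stdAddChar (N := p)) := by
    rcases sq_eq_sq_iff_eq_or_eq_neg.mp hsq with h | h
    · exact ⟨1, Or.inl rfl, by simp [h]⟩
    · exact ⟨-1, Or.inr rfl, by simp [h]⟩
  refine ⟨fun j => δ * quadraticChar (ZMod p) j, by simp, fun j hj => ?_, fun j => ?_, ?_, ?_⟩
  · rcases hδ with rfl | rfl <;> rcases quadraticChar_dichotomy hj with h | h <;> simp [h]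
  · simp only [neg_eq_neg_one_mul j, map_mul]
    ring
  · rw [← Finset.mul_sum, quadraticChar_sum_zero hchar, mul_zero]
  · rw [hδG, hsum, Finset.mul_sum]
    exact Finset.sum_congr rfl fun j _ => by push_cast; ring

end AdditiveCharacter

section LevelCount

variable (p : ℕ) {F : Type*} [Field F] [Fintype F] [Algebra (ZMod p) F]

/-- The number of solutions `x` of `f x - Tr (β x) = j`. -/
def levelCount (f : F → ZMod p) (β : F) (j : ZMod p) : ℤ :=
  (Finset.univ.filter fun x => f x - Algebra.trace (ZMod p) F (β * x) = j).card

variable [Fact p.Prime]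

lemma sum_levelCount (f : F → ZMod p) (β : F) :
    ∑ j, levelCount p f β j = Fintype.card F := by
  simp only [levelCount]
  rw [← Nat.cast_sum, ← Finset.card_eq_sum_card_fiberwise (fun _ _ => Finset.mem_univ _),
    Finset.card_univ]

lemma walsh_eq_sum_levelCount (f : F → ZMod p) (β : F) :
    walsh p f β = ∑ j, (levelCount p f β j : ℂ) * ep p j := by
  rw [walsh, ← Finset.sum_fiberwise (s := Finset.univ)
    (g := fun x => f x - Algebra.trace (ZMod p) F (β * x))]
  refine Finset.sum_congr rfl fun j _ => ?_
  rw [Finset.sum_congr rfl (g := fun _ => ep p j)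
    fun x hx => by rw [(Finset.mem_filter.mp hx).2]]
  simp [levelCount]

lemma sum_shift_mul_ep (τ : ZMod p → ℤ) (i : ZMod p) :
    ∑ j, (τ (j - i) : ℂ) * ep p j = (∑ j, (τ j : ℂ) * ep p j) * ep p i := by
  rw [Finset.sum_mul, ← Equiv.sum_comp (Equiv.addRight i)]
  refine Finset.sum_congr rfl fun j _ => ?_
  rw [Equiv.coe_addRight, add_sub_cancel_right, ep_add, mul_assoc]

/-- A Walsh coefficient of the form `c G ξ^i`, with `G` the Gauss sum of the weight function `τ`,
determines the level counts. -/
lemma mul_levelCount_eq (f : F → ZMod p) (β : F) (τ : ZMod p → ℤ) (hτ : ∑ j, τ j = 0)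
    (c : ℤ) (i : ZMod p) (h : walsh p f β = c * (∑ j, (τ j : ℂ) * ep p j) * ep p i)
    (j : ZMod p) :
    (p : ℤ) * levelCount p f β j = Fintype.card F + p * (c * τ (j - i)) := by
  have hrel : ∑ j, ((levelCount p f β j - c * τ (j - i) : ℤ) : ℂ) * ep p j = 0 := by
    push_cast
    simp only [sub_mul, Finset.sum_sub_distrib, mul_assoc]
    rw [← Finset.mul_sum, sum_shift_mul_ep, ← walsh_eq_sum_levelCount, h]
    ring
  have hsum : ∑ j, τ (j - i) = 0 := by
    rw [← hτ]
    exact Equiv.sum_comp (Equiv.subRight i) τ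
  have := mul_coeff_eq_sum_of_sum_ep_eq_zero p _ hrel j
  rw [Finset.sum_sub_distrib, sum_levelCount, ← Finset.mul_sum, hsum] at this
  linarith

lemma sum_ep_trace_mul (x : F) :
    ∑ β : F, ep p (Algebra.trace (ZMod p) F (β * x)) =
      if x = 0 then (Fintype.card F : ℂ) else 0 := by
  split_ifs with hx
  · simp [hx, ep_zero]
  · set ψ : AddChar F ℂ := (ZMod.stdAddChar (N := p)).compAddMonoidHom
      ((Algebra.trace (ZMod p) F).toAddMonoidHom.comp (AddMonoidHom.mulRight x)) with hψ
    have hψβ (β : F) : ψ β = ep p (Algebra.trace (ZMod p) F (β * x)) := by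
      rw [ep_eq_stdAddChar]
      rfl
    have hne : ψ ≠ 1 := by
      intro h1
      refine hx ((traceForm_nondegenerate (ZMod p) F).1 x fun β => ?_)
      have := DFunLike.congr_fun h1 β
      rw [hψβ, ep_eq_stdAddChar, AddChar.one_apply,
        ← (ZMod.stdAddChar (N := p)).map_zero_eq_one] at this
      rw [Algebra.traceForm_apply, mul_comm]
      exact ZMod.injective_stdAddChar this
    simp only [← hψβ]
    exact AddChar.sum_eq_zero_of_ne_one hne

lemma walsh_zero_left {β : F} (hβ : β ≠ 0) : walsh p (0 : F → ZMod p) β = 0 := by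
  have h := sum_ep_trace_mul p (-β)
  rw [if_neg (neg_ne_zero.mpr hβ)] at h
  rw [walsh, ← h]
  refine Finset.sum_congr rfl fun x _ => ?_
  rw [Pi.zero_apply, zero_sub, ← map_neg, mul_neg, mul_comm]

lemma mul_card_trace_eq_zero {β : F} (hβ : β ≠ 0) :
    (p : ℤ) * (Finset.univ.filter fun x : F => Algebra.trace (ZMod p) F (β * x) = 0).card =
      Fintype.card F := by
  have h := mul_levelCount_eq p (0 : F → ZMod p) β 0 (by simp) 0 0
    (by rw [walsh_zero_left p hβ]; simp) 0
  simpa [levelCount] using h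

lemma sum_walsh (f : F → ZMod p) :
    ∑ β, walsh p f β = Fintype.card F * ep p (f 0) := by
  simp only [walsh]
  rw [Finset.sum_comm, Finset.sum_eq_single 0]
  · simp
  · intro x _ hx
    have h := sum_ep_trace_mul p (-x)
    rw [if_neg (neg_ne_zero.mpr hx)] at h
    simp only [sub_eq_add_neg, ep_add, ← map_neg, ← mul_neg]
    rw [← Finset.mul_sum, h, mul_zero]
  · simp

lemma sum_walsh_mul_conj (f : F → ZMod p) :
    ∑ β, walsh p f β * (starRingEnd ℂ) (walsh p f β) = (Fintype.card F : ℂ) ^ 2 := by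
  have hterm (β x y : F) : ep p (f x - Algebra.trace (ZMod p) F (β * x)) *
      (starRingEnd ℂ) (ep p (f y - Algebra.trace (ZMod p) F (β * y))) =
      ep p (f x - f y) * ep p (Algebra.trace (ZMod p) F (β * (y - x))) := by
    rw [conj_ep, ← ep_add, ← ep_add, mul_sub, map_sub]
    congr 1
    ring
  simp only [walsh, map_sum, Finset.sum_mul_sum, hterm]
  rw [Finset.sum_comm]
  have hx (x : F) : ∑ β : F, ∑ y, ep p (f x - f y) *
      ep p (Algebra.trace (ZMod p) F (β * (y - x))) = Fintype.card F := by
    rw [Finset.sum_comm]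
    simp only [← Finset.mul_sum, sum_ep_trace_mul, sub_eq_zero]
    simp [ep_zero]
  simp [hx, pow_two]

/-- Counting the pairs `(z, x)` with `f x = Tr (z β x)` by `x`. -/
lemma sum_levelCount_smul (f : F → ZMod p) (β : F) :
    ∑ z : ZMod p, levelCount p f (algebraMap (ZMod p) F z * β) 0 =
      p * (Finset.univ.filter fun x : F =>
        f x = 0 ∧ Algebra.trace (ZMod p) F (β * x) = 0).card +
      (Fintype.card F -
        (Finset.univ.filter fun x : F => Algebra.trace (ZMod p) F (β * x) = 0).card) := by
  have htr (z : ZMod p) (x : F) : Algebra.trace (ZMod p) F (algebraMap (ZMod p) F z * β * x) =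
      z * Algebra.trace (ZMod p) F (β * x) := by
    rw [mul_assoc, ← Algebra.smul_def, map_smul, smul_eq_mul]
  have hx (x : F) :
      ∑ z : ZMod p, (if f x - z * Algebra.trace (ZMod p) F (β * x) = 0 then (1 : ℤ) else 0) =
      p * (if f x = 0 ∧ Algebra.trace (ZMod p) F (β * x) = 0 then 1 else 0) +
        (1 - if Algebra.trace (ZMod p) F (β * x) = 0 then 1 else 0) := by
    by_cases ht : Algebra.trace (ZMod p) F (β * x) = 0
    · by_cases hf : f x = 0 <;> simp [ht, hf, ZMod.card]
    · rw [Finset.sum_eq_single (f x / Algebra.trace (ZMod p) F (β * x))]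
      · simp [ht]
      · intro z _ hz
        refine if_neg fun h => hz ?_
        rw [eq_div_iff ht, sub_eq_zero.mp h]
      · simp
  simp only [levelCount, htr, Finset.card_filter, Nat.cast_sum, Nat.cast_ite, Nat.cast_one,
    Nat.cast_zero]
  rw [Finset.sum_comm]
  simp only [hx, Finset.sum_add_distrib, Finset.sum_sub_distrib, ← Finset.mul_sum]
  simp

lemma levelCount_smul_zero {f : F → ZMod p} {h : ℕ} (hh : 0 < h)
    (hgcd : Nat.gcd (h - 1) (p - 1) = 1)
    (hhom : ∀ (a : (ZMod p)ˣ) (x : F),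
      f (algebraMap (ZMod p) F (a : ZMod p) * x) = (a : ZMod p) ^ h * f x)
    (u : (ZMod p)ˣ) (β : F) :
    levelCount p f (algebraMap (ZMod p) F (u : ZMod p) * β) 0 = levelCount p f β 0 := by
  have hcop : (Nat.card (ZMod p)ˣ).Coprime (h - 1) := by
    rw [Nat.card_eq_fintype_card, ZMod.card_units, Nat.coprime_comm]
    exact hgcd
  obtain ⟨a, rfl⟩ := (powCoprime hcop).surjective u
  obtain ⟨k, rfl⟩ : ∃ k, h = k + 1 := ⟨h - 1, by omega⟩
  have ha : algebraMap (ZMod p) F (a : ZMod p) ≠ 0 := by simp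
  refine (congrArg Nat.cast (Finset.card_equiv (Equiv.mulLeft₀ _ ha) fun x => ?_)).symm
  have key : f (algebraMap (ZMod p) F (a : ZMod p) * x) -
      Algebra.trace (ZMod p) F (algebraMap (ZMod p) F ((a ^ k : (ZMod p)ˣ) : ZMod p) * β *
        (algebraMap (ZMod p) F (a : ZMod p) * x)) =
      (a : ZMod p) ^ (k + 1) * (f x - Algebra.trace (ZMod p) F (β * x)) := by
    rw [hhom, mul_sub]
    congr 1
    rw [← smul_eq_mul (a := (a : ZMod p) ^ (k + 1)), ← map_smul, Algebra.smul_def]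
    congr 1
    rw [Units.val_pow_eq_pow_val, map_pow, map_pow]
    ring
  simp only [Finset.mem_filter, Finset.mem_univ, true_and, Equiv.mulLeft₀_apply, powCoprime_apply,
    Nat.add_sub_cancel, key]
  simp

end LevelCount

section Weights

variable (p : ℕ) {F : Type*} [Field F] [Fintype F] [Algebra (ZMod p) F]

lemma levelCount_zero_zero (f : F → ZMod p) :
    levelCount p f 0 0 = (Finset.univ.filter fun x => f x = 0).card := by
  simp [levelCount]

lemma card_Dzero_add_one {f : F → ZMod p} (hf0 : f 0 = 0) :
    ((Dzero p f).card : ℤ) + 1 = levelCount p f 0 0 := by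
  have h : (Finset.univ.filter fun x => f x = 0) = insert 0 (Dzero p f) := by
    ext x
    by_cases hx : x = 0 <;> simp [Dzero, hx, hf0]
  rw [levelCount_zero_zero, h, Finset.card_insert_of_notMem (by simp [Dzero])]
  simp

lemma wtOn_Dzero (f : F → ZMod p) (β : F) :
    (wtOn p (Dzero p f) β : ℤ) = levelCount p f 0 0 -
      (Finset.univ.filter fun x : F =>
        f x = 0 ∧ Algebra.trace (ZMod p) F (β * x) = 0).card := by
  have h : (Dzero p f).filter (fun d => Algebra.trace (ZMod p) F (β * d) ≠ 0) =
      (Finset.univ.filter fun x => f x = 0).filter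
        fun d => ¬ Algebra.trace (ZMod p) F (β * d) = 0 := by
    ext x
    by_cases hx : x = 0 <;> simp [Dzero, hx]
  rw [levelCount_zero_zero, wtOn, h, ← Finset.filter_filter,
    ← Finset.card_filter_add_card_filter_not (s := Finset.univ.filter fun x => f x = 0)
      (fun d => Algebra.trace (ZMod p) F (β * d) = 0)]
  push_cast
  ring

variable [Fact p.Prime]

lemma odd_levelCount_zero_zero (hp : p ≠ 2) {f : F → ZMod p} (hf0 : f 0 = 0)
    (hneg : ∀ x, f (-x) = f x) : Odd (levelCount p f 0 0) := by
  have h2 : (2 : F) ≠ 0 := by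
    have h2' : (2 : ZMod p) ≠ 0 := by
      apply Ring.two_ne_zero
      rwa [ZMod.ringChar_zmod_n]
    rw [← map_ofNat (algebraMap (ZMod p) F) 2]
    simpa using h2'
  have hsum : ∑ _x ∈ Dzero p f, (1 : ZMod 2) = 0 := by
    refine Finset.sum_involution (fun x _ => -x) (fun _ _ => by decide) (fun x hx _ hxx => ?_)
      (fun x hx => ?_) (fun x _ => neg_neg x)
    · have hx0 : x ≠ 0 := (Finset.mem_filter.mp hx).2.1
      refine mul_ne_zero h2 hx0 ?_
      rw [two_mul]
      nth_rewrite 1 [← hxx]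
      exact neg_add_cancel x
    · simpa [Dzero, hneg] using hx
  have hD : Even (Dzero p f).card := by
    rw [← ZMod.natCast_eq_zero_iff_even]
    simpa using hsum
  rw [← card_Dzero_add_one p hf0]
  exact (Int.even_coe_nat _ |>.mpr hD).add_one

lemma sq_mul_wtOn_Dzero {f : F → ZMod p} {β : F} (hβ : β ≠ 0) {e : ℤ}
    (h0 : (p : ℤ) * levelCount p f 0 0 = Fintype.card F)
    (hlevel : (p : ℤ) * levelCount p f β 0 = Fintype.card F + p * e)
    (hsmul : ∀ u : (ZMod p)ˣ, levelCount p f (algebraMap (ZMod p) F (u : ZMod p) * β) 0 =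
      levelCount p f β 0) :
    (p : ℤ) ^ 2 * wtOn p (Dzero p f) β = (p - 1) * (Fintype.card F - p * e) := by
  have hT := mul_card_trace_eq_zero p hβ
  have hZ := sum_levelCount_smul p f β
  have hS : ∑ z : ZMod p, levelCount p f (algebraMap (ZMod p) F z * β) 0 =
      levelCount p f 0 0 + (p - 1) * levelCount p f β 0 := by
    rw [← Finset.add_sum_erase _ _ (Finset.mem_univ (0 : ZMod p)), map_zero, zero_mul,
      Finset.sum_congr rfl (g := fun _ => levelCount p f β 0)
        fun z hz => hsmul (Units.mk0 z (Finset.ne_of_mem_erase hz))]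
    rw [Finset.sum_const, Finset.card_erase_of_mem (Finset.mem_univ _), Finset.card_univ,
      ZMod.card, nsmul_eq_mul, Nat.cast_sub (NeZero.one_le), Nat.cast_one]
  rw [wtOn_Dzero]
  linear_combination (p : ℤ) * hZ - (p : ℤ) * hS + (p - 1) * h0 - (p - 1) * hlevel - hT

end Weights

section Support

variable (p : ℕ) [Fact p.Prime] {F : Type*} [Field F] [Fintype F] [Algebra (ZMod p) F]

lemma card_support_mul {f g : F → ZMod p} {C : ℂ}
    (hW : ∀ β, walsh p f β ≠ 0 → walsh p f β = C * ep p (g β)) :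
    ((Finset.univ.filter fun β => walsh p f β ≠ 0).card : ℂ) * (C * (starRingEnd ℂ) C) =
      (Fintype.card F : ℂ) ^ 2 := by
  rw [← sum_walsh_mul_conj p f, ← nsmul_eq_mul, ← Finset.sum_const, Finset.sum_filter]
  refine Finset.sum_congr rfl fun β _ => ?_
  split_ifs with h
  · rw [hW β h, map_mul, conj_ep]
    have : ep p (g β) * ep p (-g β) = 1 := by rw [← ep_add, add_neg_cancel, ep_zero]
    linear_combination -(C * (starRingEnd ℂ) C) * this
  · rw [not_not.mp h, zero_mul]

/-- The number of points of the Walsh support at which the dual takes the value `j`. -/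
def dualCount (f g : F → ZMod p) (j : ZMod p) : ℤ :=
  ((Finset.univ.filter fun β => walsh p f β ≠ 0).filter fun β => g β = j).card

lemma sum_dualCount (f g : F → ZMod p) :
    ∑ j, dualCount p f g j = (Finset.univ.filter fun β => walsh p f β ≠ 0).card := by
  simp only [dualCount]
  rw [← Nat.cast_sum, ← Finset.card_eq_sum_card_fiberwise (fun _ _ => Finset.mem_univ _)]

lemma sum_support_comp {R : Type*} [CommRing R] (f g : F → ZMod p) (φ : ZMod p → R) :
    ∑ β with walsh p f β ≠ 0, φ (g β) = ∑ j, (dualCount p f g j : R) * φ j := by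
  rw [← Finset.sum_fiberwise (g := g)]
  refine Finset.sum_congr rfl fun j _ => ?_
  rw [Finset.sum_congr rfl (g := fun _ => φ j)
    fun x hx => by rw [(Finset.mem_filter.mp hx).2]]
  simp [dualCount]

lemma mul_dualCount {f g : F → ZMod p} (hf0 : f 0 = 0) {τ : ZMod p → ℤ} (hτ : ∑ j, τ j = 0)
    {G : ℂ} (hG : ∑ j, (τ j : ℂ) * ep p j = G) {P : ℤ} (hP : G ^ 2 = P) {c : ℤ}
    (hW : ∀ β, walsh p f β ≠ 0 → walsh p f β = c * G * ep p (g β)) (j : ZMod p) :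
    (p : ℤ) * (c * P * dualCount p f g j - Fintype.card F * τ j) =
      c * P * (Finset.univ.filter fun β => walsh p f β ≠ 0).card := by
  have hsum : c * G * ∑ j, (dualCount p f g j : ℂ) * ep p j = Fintype.card F := by
    have h := sum_walsh p f
    rw [hf0, ep_zero, mul_one] at h
    rw [← h, ← sum_support_comp p f g, Finset.mul_sum, Finset.sum_filter]
    refine Finset.sum_congr rfl fun β _ => ?_
    split_ifs with hβ
    · exact (hW β hβ).symm
    · exact (not_not.mp hβ).symm
  have hrel : ∑ j, ((c * P * dualCount p f g j - Fintype.card F * τ j : ℤ) : ℂ) * ep p j = 0 := by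
    push_cast
    simp only [sub_mul, Finset.sum_sub_distrib, mul_assoc, ← Finset.mul_sum]
    rw [hG, ← hP]
    linear_combination G * hsum
  rw [mul_coeff_eq_sum_of_sum_ep_eq_zero p _ hrel j, Finset.sum_sub_distrib, ← Finset.mul_sum,
    ← Finset.mul_sum, sum_dualCount, hτ]
  ring

end Support

section WeightFunction

lemma sqrtPStar_mul_conj (p : ℕ) : sqrtPStar p * (starRingEnd ℂ) (sqrtPStar p) = p := by
  have hsq : ((Real.sqrt p : ℝ) : ℂ) * (Real.sqrt p : ℝ) = p := by
    rw [← Complex.ofReal_mul, Real.mul_self_sqrt (Nat.cast_nonneg p), Complex.ofReal_natCast]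
  rw [sqrtPStar]
  split_ifs
  · rw [Complex.conj_ofReal, hsq]
  · rw [map_mul, Complex.conj_I, Complex.conj_ofReal]
    linear_combination hsq - Complex.I_sq * ((Real.sqrt p : ℝ) : ℂ) * (Real.sqrt p : ℝ)

variable (p : ℕ) [Fact p.Prime] {F : Type*} [Field F] [Fintype F] [Algebra (ZMod p) F]

/-- The weights of the code `C_{D_f}` are governed by a function `t` with values in `{0, 1, -1}`
whose first two moments are known. -/
theorem exists_weight_function {s r : ℕ} (hp : p ≠ 2)
    (hq : Fintype.card F = p ^ (s + 2 * r + 3)) {f g : F → ZMod p} {ε : ℂ}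
    (hf : IsWRP p (s + 2 * r + 3) s f ε g) {θ : ℤ} (hθ : θ = quadraticChar (ZMod p) (-1)) :
    ∃ (e : ℤ) (t : F → ℤ), (e = 1 ∨ e = -1) ∧ ε = e ∧ t 0 = 0 ∧
      (∀ β, t β = 0 ∨ t β = 1 ∨ t β = -1) ∧
      ((Dzero p f).card : ℤ) + 1 = p ^ (s + 2 * r + 2) ∧
      (∀ β, β ≠ 0 → (wtOn p (Dzero p f) β : ℤ) =
        (p - 1) * (p ^ (s + 2 * r + 1) - e * (θ * p) ^ (s + r) * t β)) ∧
      ∑ β, t β = (p - 1) * (e * θ ^ (s + 1) * (θ * p) ^ (r + 1)) ∧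
      ∑ β, t β ^ 2 = (p - 1) * p ^ (2 * (r + 1)) := by
  obtain ⟨⟨hε, hW, hg⟩, -, hf0, h, hpos, heven, hgcd, hhom⟩ := hf
  obtain ⟨τ, hτ0, hτ1, hτneg, hτsum, hτG⟩ := exists_quadratic_sum_ep_eq_sqrtPStar p hp
  have hp0 : (p : ℤ) ≠ 0 := NeZero.ne _
  have hpodd : Odd (p : ℤ) :=
    (Int.odd_coe_nat _).mpr ((Fact.out : p.Prime).odd_of_ne_two hp)
  have hθ1 : θ = 1 ∨ θ = -1 :=
    hθ ▸ quadraticChar_dichotomy (F := ZMod p) (neg_ne_zero.mpr one_ne_zero)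
  have hθ2 : θ ^ 2 = 1 := by rcases hθ1 with h | h <;> simp [h]
  have hθpow (a : ℕ) : (θ ^ a) ^ 2 = 1 := by rw [← pow_mul, mul_comm, pow_mul, hθ2, one_pow]
  have hθ0 : θ ≠ 0 := fun h0 => by simp [h0] at hθ2
  obtain ⟨e, he, rfl⟩ : ∃ e : ℤ, (e = 1 ∨ e = -1) ∧ ε = e := by
    rcases hε with rfl | rfl
    · exact ⟨1, by simp⟩
    · exact ⟨-1, by simp⟩
  have he2 : e ^ 2 = 1 := by rcases he with rfl | rfl <;> norm_num
  have he0 : e ≠ 0 := fun h0 => by simp [h0] at he2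
  have hP : sqrtPStar p ^ 2 = ((θ * p : ℤ) : ℂ) := by
    rw [sqrtPStar_sq p hp, hθ]
    push_cast
    rfl
  set c : ℤ := e * (θ * p) ^ (s + r + 1) with hc
  have hWc (β : F) (hβ : walsh p f β ≠ 0) :
      walsh p f β = c * sqrtPStar p * ep p (g β) := by
    rw [hW β hβ, hc, show s + 2 * r + 3 + s = 2 * (s + r + 1) + 1 by ring, pow_succ, pow_mul, hP]
    push_cast
    ring
  have hlevel (β : F) : (p : ℤ) * levelCount p f β 0 =
      Fintype.card F + p * (c * (θ * τ (g β))) := by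
    rw [hθ, ← hτneg, ← zero_sub (g β)]
    by_cases hβ : walsh p f β = 0
    · rw [hg β hβ, sub_zero, hτ0]
      simpa using mul_levelCount_eq p f β τ hτsum 0 0 (by simp [hβ]) 0
    · exact mul_levelCount_eq p f β τ hτsum c (g β) (by rw [hτG, hWc β hβ]) 0
  have hneg (x : F) : f (-x) = f x := by
    simpa [heven.neg_one_pow] using hhom (-1) x
  have hg0 : g 0 = 0 := by
    by_contra hne
    have hodd := odd_levelCount_zero_zero p hp hf0 hneg
    have hτodd : Odd (τ (g 0)) := by rcases hτ1 _ hne with h | h <;> rw [h] <;> decide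
    have heodd : Odd e := by rcases he with rfl | rfl <;> decide
    have hθodd : Odd θ := by
      rcases hθ1 with h | h <;> rw [h] <;> decide
    have h1 : Odd ((p : ℤ) * levelCount p f 0 0) := hpodd.mul hodd
    rw [hlevel, hq] at h1
    refine (Int.not_even_iff_odd.mpr h1) (Odd.add_odd ?_ ?_)
    · push_cast
      exact hpodd.pow
    · exact hpodd.mul ((heodd.mul (hθodd.mul hpodd).pow).mul (hθodd.mul hτodd))
  have h0 : (p : ℤ) * levelCount p f 0 0 = Fintype.card F := by
    rw [hlevel, hg0, hτ0]
    ring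
  have hτcases (j : ZMod p) : τ j = 0 ∨ τ j = 1 ∨ τ j = -1 := by
    by_cases hj : j = 0
    · exact Or.inl (hj ▸ hτ0)
    · exact Or.inr (hτ1 j hj)
  have hτsq : ∑ j, τ j ^ 2 = (p : ℤ) - 1 := by
    rw [← Finset.add_sum_erase _ _ (Finset.mem_univ (0 : ZMod p)), hτ0,
      Finset.sum_congr rfl (g := fun _ => (1 : ℤ)) fun j hj => by
        rcases hτ1 j (Finset.ne_of_mem_erase hj) with h | h <;> rw [h] <;> norm_num]
    rw [Finset.sum_const, Finset.card_erase_of_mem (Finset.mem_univ _), Finset.card_univ,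
      ZMod.card, nsmul_eq_mul, Nat.cast_sub (NeZero.one_le)]
    simp
  have hsupp : ((Finset.univ.filter fun β => walsh p f β ≠ 0).card : ℤ) = p ^ (2 * r + 3) := by
    have h1 := card_support_mul p hWc
    rw [map_mul, map_intCast, hq] at h1
    have h2 : (((Finset.univ.filter fun β => walsh p f β ≠ 0).card : ℤ) : ℂ) *
        ((c ^ 2 * p : ℤ) : ℂ) = (((p ^ (s + 2 * r + 3)) ^ 2 : ℤ) : ℂ) := by
      push_cast at h1 ⊢
      linear_combination h1 - ((Finset.univ.filter fun β => walsh p f β ≠ 0).card : ℂ) *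
        (c : ℂ) ^ 2 * sqrtPStar_mul_conj p
    have h3 := Int.cast_injective (α := ℂ) ((Int.cast_mul _ _).trans h2)
    have h4 : c ^ 2 * p = p ^ (2 * s + 2 * r + 3) := by
      rw [hc]
      linear_combination (p : ℤ) ^ (2 * s + 2 * r + 3) * hθpow (s + r + 1) +
        (p : ℤ) ^ (2 * s + 2 * r + 3) * (θ ^ (s + r + 1)) ^ 2 * he2
    rw [h4] at h3
    refine mul_right_cancel₀ (pow_ne_zero (2 * s + 2 * r + 3) hp0) (h3.trans ?_)
    ring
  set b : ℤ := e * θ ^ (s + 1) * (θ * p) ^ (r + 1) with hb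
  have hdual (j : ZMod p) : dualCount p f g j = p ^ (2 * (r + 1)) + b * τ j := by
    have h1 := mul_dualCount p hf0 hτsum hτG hP hWc j
    rw [hsupp, hq] at h1
    have h2 : c * (θ * p) * b = p ^ (s + 2 * r + 3) := by
      rw [hc, hb]
      linear_combination (p : ℤ) ^ (s + 2 * r + 3) * hθpow (s + r + 2) +
        (p : ℤ) ^ (s + 2 * r + 3) * (θ ^ (s + r + 2)) ^ 2 * he2
    have h3 : c * (θ * p) * p ≠ 0 :=
      mul_ne_zero (mul_ne_zero (mul_ne_zero he0 (pow_ne_zero _ (mul_ne_zero hθ0 hp0)))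
        (mul_ne_zero hθ0 hp0)) hp0
    refine mul_left_cancel₀ h3 ?_
    push_cast at h1
    linear_combination h1 - p * τ j * h2
  have hmoment (φ : ZMod p → ℤ) (hφ : φ 0 = 0) :
      ∑ β, φ (g β) = p ^ (2 * (r + 1)) * ∑ j, φ j + b * ∑ j, τ j * φ j := by
    rw [← Finset.sum_filter_of_ne (p := fun β => walsh p f β ≠ 0), sum_support_comp]
    · simp only [hdual, Int.cast_id, add_mul, Finset.sum_add_distrib, Finset.mul_sum, mul_assoc]
    · intro β _ hβ hw
      exact hβ (by rw [hg β hw, hφ])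
  refine ⟨e, fun β => τ (g β), he, rfl, by simp only [hg0, hτ0], fun β => hτcases _, ?_,
    fun β hβ => ?_, ?_, ?_⟩
  · rw [card_Dzero_add_one p hf0]
    refine mul_left_cancel₀ hp0 ?_
    rw [h0, hq]
    push_cast
    ring
  · have h1 := sq_mul_wtOn_Dzero p hβ h0 (hlevel β)
      fun u => levelCount_smul_zero p hpos hgcd hhom u β
    refine mul_left_cancel₀ (pow_ne_zero 2 hp0) (h1.trans ?_)
    rw [hq, hc]
    push_cast
    linear_combination -((p : ℤ) - 1) * p ^ 2 * e * (θ * p) ^ (s + r) * τ (g β) * hθ2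
  · rw [hmoment τ hτ0, hτsum]
    simp only [← pow_two, hτsq]
    ring
  · have hcube (j : ZMod p) : τ j * τ j ^ 2 = τ j := by
      rcases hτcases j with h | h | h <;> rw [h] <;> norm_num
    rw [hmoment (fun j => τ j ^ 2) (by simp [hτ0])]
    simp only [hcube, hτsum, hτsq]
    ring

end WeightFunction

section Codewords

variable (p : ℕ) {F : Type*} [Field F] [Fintype F] [Algebra (ZMod p) F]

lemma wtOn_eq_zero_of_cword_eq_zero {D : Finset F} {β : F} (h : cword p D β = 0) :
    wtOn p D β = 0 := by
  rw [wtOn, Finset.card_eq_zero, Finset.filter_eq_empty_iff]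
  exact fun d hd => not_not.mpr (congrFun h ⟨d, hd⟩)

lemma cword_sub (D : Finset F) (β γ : F) :
    cword p D (β - γ) = cword p D β - cword p D γ := by
  funext d
  simp [cword, sub_mul]

lemma injective_cword_of_wtOn_ne_zero {D : Finset F} (h : ∀ β, β ≠ 0 → wtOn p D β ≠ 0) :
    Function.Injective (cword p D) := by
  intro β γ hβγ
  by_contra hne
  refine h _ (sub_ne_zero.mpr hne) (wtOn_eq_zero_of_cword_eq_zero p ?_)
  rw [cword_sub, hβγ, sub_self]

end Codewords

lemma two_mul_card_filter_eq {ι : Type*} [Fintype ι] {t : ι → ℤ}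
    (ht : ∀ i, t i = 0 ∨ t i = 1 ∨ t i = -1) {δ : ℤ} (hδ : δ = 1 ∨ δ = -1) :
    2 * ((Finset.univ.filter fun i => t i = δ).card : ℤ) = ∑ i, t i ^ 2 + δ * ∑ i, t i := by
  rw [Finset.card_filter, Finset.mul_sum, ← Finset.sum_add_distrib]
  push_cast
  rw [Finset.mul_sum]
  refine Finset.sum_congr rfl fun i _ => ?_
  rcases hδ with rfl | rfl <;> rcases ht i with h | h | h <;> rw [h] <;> norm_num

lemma card_filter_eq_zero {ι : Type*} [Fintype ι] {t : ι → ℤ}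
    (ht : ∀ i, t i = 0 ∨ t i = 1 ∨ t i = -1) :
    ((Finset.univ.filter fun i => t i = 0).card : ℤ) = Fintype.card ι - ∑ i, t i ^ 2 := by
  rw [Finset.card_filter, ← Finset.card_univ, Finset.card_eq_sum_ones]
  push_cast
  rw [← Finset.sum_sub_distrib]
  refine Finset.sum_congr rfl fun i _ => ?_
  rcases ht i with h | h | h <;> rw [h] <;> norm_num

theorem statement_11 (p n s : ℕ) [Fact p.Prime] (hp : p ≠ 2) (hn : 0 < n) (hs : s ≤ n)
    {F : Type*} [Field F] [Fintype F] [Algebra (ZMod p) F]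
    (hq : Fintype.card F = p ^ n)
    (f g : F → ZMod p) (ε : ℂ)
    (hf : IsWRP p n s f ε g)
    (hodd : Odd (n + s)) (hcond : s + 3 ≤ n) :
    -- (a) the length of the code
    (Dzero p f).card = p ^ (n - 1) - 1 ∧
    -- (b) the code has dimension n
    Function.Injective (cword p (Dzero p f)) ∧
    -- (c) weights and multiplicities
    (((Finset.univ.filter fun β : F => β ≠ 0 ∧
        (wtOn p (Dzero p f) β : ℂ) = ((p : ℂ) - 1) * (p : ℂ) ^ ((n : ℤ) - 2)).card : ℂ)
      = (p : ℂ) ^ (n : ℤ) + (p : ℂ) ^ ((n : ℤ) - s - 1) - (p : ℂ) ^ ((n : ℤ) - s) - 1) ∧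
    (((Finset.univ.filter fun β : F => β ≠ 0 ∧
        (wtOn p (Dzero p f) β : ℂ) = ((p : ℂ) - 1) * ((p : ℂ) ^ ((n : ℤ) - 2) - ε * sqrtPStar p ^ ((n : ℤ) + s - 3))).card : ℂ)
      = (((p : ℂ) - 1) / 2) * ((p : ℂ) ^ ((n : ℤ) - s - 1) + ε * (eta0 p (-1)) ^ n * sqrtPStar p ^ ((n : ℤ) - s - 1))) ∧
    (((Finset.univ.filter fun β : F => β ≠ 0 ∧
        (wtOn p (Dzero p f) β : ℂ) = ((p : ℂ) - 1) * ((p : ℂ) ^ ((n : ℤ) - 2) + ε * sqrtPStar p ^ ((n : ℤ) + s - 3))).card : ℂ)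
      = (((p : ℂ) - 1) / 2) * ((p : ℂ) ^ ((n : ℤ) - s - 1) - ε * (eta0 p (-1)) ^ n * sqrtPStar p ^ ((n : ℤ) - s - 1))) ∧
    -- minimum distance
    (∀ β : F, cword p (Dzero p f) β ≠ 0 →
      (p - 1) * (p ^ (n - 2) - p ^ ((n + s - 3) / 2)) ≤ wtOn p (Dzero p f) β) ∧
    (∃ β : F, cword p (Dzero p f) β ≠ 0 ∧
      wtOn p (Dzero p f) β = (p - 1) * (p ^ (n - 2) - p ^ ((n + s - 3) / 2))) ∧
    -- three-weight code
    ((Finset.univ.filter fun β : F => cword p (Dzero p f) β ≠ 0).image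
        (wtOn p (Dzero p f))).card = 3 := by
  obtain ⟨r, rfl⟩ : ∃ r, n = s + 2 * r + 3 := by
    obtain ⟨k, hk⟩ := hodd
    exact ⟨k - s - 1, by omega⟩
  obtain ⟨θ, hθ⟩ : ∃ θ : ℤ, θ = quadraticChar (ZMod p) (-1) := ⟨_, rfl⟩
  obtain ⟨e, t, he, rfl, ht0, ht, hlen, hwt, hsum, hsumsq⟩ := exists_weight_function p hp hq hf hθ
  have hp2 : (2 : ℤ) ≤ p := by exact_mod_cast (Fact.out : p.Prime).two_le
  have hp1 : (1 : ℤ) < p := by linarith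
  have hpm : (0 : ℤ) < (p : ℤ) - 1 := by linarith
  have hθ1 : θ = 1 ∨ θ = -1 :=
    hθ ▸ quadraticChar_dichotomy (F := ZMod p) (neg_ne_zero.mpr one_ne_zero)
  have hθ2 : θ ^ 2 = 1 := by rcases hθ1 with h | h <;> simp [h]
  have hsign (a : ℕ) : e * θ ^ a = 1 ∨ e * θ ^ a = -1 := by
    rcases he with rfl | rfl <;> rcases hθ1 with rfl | rfl <;>
      rcases neg_one_pow_eq_or ℤ a with h | h <;> simp [h]
  have hsqrt (a : ℕ) : sqrtPStar p ^ (2 * a) = (((θ * p) ^ a : ℤ) : ℂ) := by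
    rw [pow_mul, sqrtPStar_sq p hp, hθ]
    push_cast
    rfl
  obtain ⟨σ, hσ, hA⟩ : ∃ σ : ℤ, (σ = 1 ∨ σ = -1) ∧ e * (θ * p) ^ (s + r) = σ * p ^ (s + r) :=
    ⟨_, hsign (s + r), by ring⟩
  obtain ⟨ρ, hρ, hB⟩ : ∃ ρ : ℤ, (ρ = 1 ∨ ρ = -1) ∧
      e * θ ^ (s + 1) * (θ * p) ^ (r + 1) = ρ * p ^ (r + 1) :=
    ⟨_, hsign (s + r + 2), by ring⟩
  have hσ2 : σ * σ = 1 := by rcases hσ with rfl | rfl <;> norm_num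
  have hpk : (0 : ℤ) < p ^ (s + r) := by positivity
  have hlt : (p : ℤ) ^ (s + r) < p ^ (s + 2 * r + 1) := pow_lt_pow_right₀ hp1 (by omega)
  have hwt' (β : F) (hβ : β ≠ 0) : (wtOn p (Dzero p f) β : ℤ) =
      (p - 1) * (p ^ (s + 2 * r + 1) - p ^ (s + r) * (σ * t β)) := by
    rw [hwt β hβ, hA]
    ring
  have hσt (β : F) : σ * t β ≤ 1 := by
    rcases hσ with rfl | rfl <;> rcases ht β with h | h | h <;> rw [h] <;> norm_num
  have hmin (β : F) (hβ : β ≠ 0) :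
      ((p : ℤ) - 1) * (p ^ (s + 2 * r + 1) - p ^ (s + r)) ≤ wtOn p (Dzero p f) β := by
    rw [hwt' β hβ]
    refine mul_le_mul_of_nonneg_left ?_ hpm.le
    nlinarith [hσt β]
  have hwt0 (β : F) (hβ : β ≠ 0) : wtOn p (Dzero p f) β ≠ 0 := by
    have h1 := hmin β hβ
    have h2 : 0 < ((p : ℤ) - 1) * (p ^ (s + 2 * r + 1) - p ^ (s + r)) :=
      mul_pos hpm (sub_pos.mpr hlt)
    omega
  have hinj := injective_cword_of_wtOn_ne_zero p hwt0
  have hcz : cword p (Dzero p f) 0 = 0 := by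
    funext d
    simp [cword]
  have hcw (β : F) : cword p (Dzero p f) β ≠ 0 ↔ β ≠ 0 := by
    rw [← hcz]
    exact hinj.ne_iff
  have hiff (β : F) (hβ : β ≠ 0) (δ : ℤ) : (wtOn p (Dzero p f) β : ℤ) =
      (p - 1) * (p ^ (s + 2 * r + 1) - e * (θ * p) ^ (s + r) * δ) ↔ t β = δ := by
    refine ⟨fun h => ?_, fun h => h ▸ hwt β hβ⟩
    rw [hwt β hβ, hA] at h
    have h1 := sub_right_injective (mul_left_cancel₀ hpm.ne' h)
    refine mul_left_cancel₀ (mul_ne_zero ?_ hpk.ne') h1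
    rintro rfl
    simp at hσ2
  have hfilter (v : ℂ) (δ : ℤ) (hv : v = (((p - 1) *
      (p ^ (s + 2 * r + 1) - e * (θ * p) ^ (s + r) * δ) : ℤ) : ℂ)) :
      (Finset.univ.filter fun β : F => β ≠ 0 ∧ (wtOn p (Dzero p f) β : ℂ) = v) =
        Finset.univ.filter fun β : F => β ≠ 0 ∧ t β = δ := by
    ext β
    simp only [Finset.mem_filter, Finset.mem_univ, true_and]
    refine and_congr_right fun hβ => ?_
    rw [← hiff β hβ δ, hv]
    norm_cast
  have hne0 {δ : ℤ} (hδ : δ = 1 ∨ δ = -1) (β : F) : β ≠ 0 ∧ t β = δ ↔ t β = δ := by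
    refine and_iff_right_of_imp fun h hβ => ?_
    rw [hβ, ht0] at h
    omega
  have hcount {δ : ℤ} (hδ : δ = 1 ∨ δ = -1) :
      2 * ((Finset.univ.filter fun β : F => β ≠ 0 ∧ t β = δ).card : ℤ) =
        (p - 1) * (p ^ (2 * (r + 1)) + δ * (e * θ ^ (s + 1) * (θ * p) ^ (r + 1))) := by
    simp only [hne0 hδ]
    rw [two_mul_card_filter_eq ht hδ, hsum, hsumsq]
    ring
  have hcount0 : ((Finset.univ.filter fun β : F => β ≠ 0 ∧ t β = 0).card : ℤ) =
      p ^ (s + 2 * r + 3) - (p - 1) * p ^ (2 * (r + 1)) - 1 := by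
    have h := card_filter_eq_zero ht
    have hins : (Finset.univ.filter fun β : F => t β = 0) =
        insert 0 (Finset.univ.filter fun β : F => β ≠ 0 ∧ t β = 0) := by
      ext β
      by_cases hβ : β = 0 <;> simp [hβ, ht0]
    rw [hins, Finset.card_insert_of_notMem (by simp), hsumsq, hq] at h
    push_cast at h
    linarith
  have hex {δ : ℤ} (hδ : δ = 1 ∨ δ = -1) : ∃ β : F, β ≠ 0 ∧ t β = δ := by
    have h := hcount hδ
    have h1 : (0 : ℤ) < p ^ (2 * (r + 1)) + δ * (ρ * p ^ (r + 1)) := by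
      have h2 : (p : ℤ) ^ (r + 1) < p ^ (2 * (r + 1)) := pow_lt_pow_right₀ hp1 (by omega)
      have h3 : (0 : ℤ) < p ^ (r + 1) := by positivity
      rcases hδ with rfl | rfl <;> rcases hρ with rfl | rfl <;> linarith
    have h2 := mul_pos hpm h1
    rw [← hB, ← h] at h2
    obtain ⟨β, hβ⟩ := Finset.card_pos.mp (by omega : 0 <
      (Finset.univ.filter fun β : F => β ≠ 0 ∧ t β = δ).card)
    exact ⟨β, (Finset.mem_filter.mp hβ).2⟩
  have hex0 : ∃ β : F, β ≠ 0 ∧ t β = 0 := by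
    have h1 : (p : ℤ) ^ (2 * (r + 1)) > 1 := one_lt_pow₀ hp1 (by omega)
    have h2 : (p : ℤ) ^ (2 * r + 3) ≤ p ^ (s + 2 * r + 3) :=
      pow_le_pow_right₀ hp1.le (by omega)
    have h3 : (p : ℤ) ^ (2 * r + 3) = p * p ^ (2 * (r + 1)) := by ring
    obtain ⟨β, hβ⟩ := Finset.card_pos.mp (by
      zify
      rw [hcount0]
      nlinarith : 0 < (Finset.univ.filter fun β : F => β ≠ 0 ∧ t β = 0).card)
    exact ⟨β, (Finset.mem_filter.mp hβ).2⟩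
  have hη : eta0 p (-1) = (θ : ℂ) := by rw [hθ, eta0]
  have hz1 : ((s + 2 * r + 3 : ℕ) : ℤ) - 2 = ((s + 2 * r + 1 : ℕ) : ℤ) := by push_cast; ring
  have hz2 : ((2 * r + 3 : ℕ) : ℤ) - 1 = ((2 * (r + 1) : ℕ) : ℤ) := by push_cast; ring
  have hz3 : ((s + 2 * r + 3 : ℕ) : ℤ) - s = ((2 * r + 3 : ℕ) : ℤ) := by push_cast; ring
  have hz4 : ((s + 2 * r + 3 : ℕ) : ℤ) + s - 3 = ((2 * (s + r) : ℕ) : ℤ) := by push_cast; ring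
  have hn1 : s + 2 * r + 3 - 1 = s + 2 * r + 2 := by omega
  have hn2 : s + 2 * r + 3 - 2 = s + 2 * r + 1 := by omega
  have hn3 : (s + 2 * r + 3 + s - 3) / 2 = s + r := by omega
  have hdist : (((p - 1) * (p ^ (s + 2 * r + 1) - p ^ (s + r)) : ℕ) : ℤ) =
      (p - 1) * (p ^ (s + 2 * r + 1) - p ^ (s + r)) := by
    have h1 : p ^ (s + r) ≤ p ^ (s + 2 * r + 1) := by exact_mod_cast hlt.le
    have h2 : 1 ≤ p := by exact_mod_cast hp1.le
    push_cast [h1, h2]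
    rfl
  have hbeta : (e : ℂ) * (θ : ℂ) ^ (s + 2 * r + 3) * (((θ * p) ^ (r + 1) : ℤ) : ℂ) =
      ((e * θ ^ (s + 1) * (θ * p) ^ (r + 1) : ℤ) : ℂ) := by
    have h1 : θ ^ (s + 2 * r + 3) = θ ^ (s + 1) := by
      rw [show s + 2 * r + 3 = s + 1 + 2 * (r + 1) by ring, pow_add, pow_mul, hθ2, one_pow, mul_one]
    rw [← h1]
    push_cast
    ring
  have hcountC {δ : ℤ} (hδ : δ = 1 ∨ δ = -1) :
      ((Finset.univ.filter fun β : F => β ≠ 0 ∧ t β = δ).card : ℂ) =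
        (((p : ℂ) - 1) / 2) * ((p : ℂ) ^ (2 * (r + 1)) +
          δ * ((e * θ ^ (s + 1) * (θ * p) ^ (r + 1) : ℤ) : ℂ)) := by
    have h := congrArg (Int.cast : ℤ → ℂ) (hcount hδ)
    push_cast at h ⊢
    linear_combination h / 2
  simp only [hz1, hz2, hz3, hz4, hn1, hn2, hn3, zpow_natCast, hη, hsqrt, hbeta, hcw]
  refine ⟨?_, hinj, ?_, ?_, ?_, fun β hβ => ?_, ?_, ?_⟩
  · have : (p : ℤ) ^ (s + 2 * r + 2) = ((p ^ (s + 2 * r + 2) : ℕ) : ℤ) := by push_cast; rfl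
    rw [this] at hlen
    omega
  · rw [hfilter _ 0 (by push_cast; ring)]
    have h := congrArg (Int.cast : ℤ → ℂ) hcount0
    push_cast at h
    rw [h]
    ring
  · rw [hfilter _ 1 (by push_cast; ring), hcountC (Or.inl rfl)]
    push_cast
    ring
  · rw [hfilter _ (-1) (by push_cast; ring), hcountC (Or.inr rfl)]
    push_cast
    ring
  · refine Int.ofNat_le.mp ?_
    rw [hdist]
    exact hmin β hβ
  · obtain ⟨β, hβ, htβ⟩ := hex hσ
    refine ⟨β, hβ, Nat.cast_injective (R := ℤ) ?_⟩
    rw [hdist, hwt' β hβ, htβ, hσ2, mul_one]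
  · obtain ⟨β₀, hβ₀, h₀⟩ := hex0
    obtain ⟨β₁, hβ₁, h₁⟩ := hex (Or.inl rfl)
    obtain ⟨β₂, hβ₂, h₂⟩ := hex (Or.inr rfl)
    have heq {β γ : F} (hβ : β ≠ 0) (hγ : γ ≠ 0) :
        wtOn p (Dzero p f) β = wtOn p (Dzero p f) γ ↔ t β = t γ := by
      rw [← hiff β hβ, ← hwt γ hγ, Nat.cast_inj]
    refine Finset.card_eq_three.mpr ⟨wtOn p (Dzero p f) β₀, wtOn p (Dzero p f) β₁,
      wtOn p (Dzero p f) β₂, ?_, ?_, ?_, ?_⟩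
    · rw [Ne, heq hβ₀ hβ₁, h₀, h₁]
      decide
    · rw [Ne, heq hβ₀ hβ₂, h₀, h₂]
      decide
    · rw [Ne, heq hβ₁ hβ₂, h₁, h₂]
      decide
    · ext w
      simp only [Finset.mem_image, Finset.mem_filter, Finset.mem_univ, true_and,
        Finset.mem_insert, Finset.mem_singleton]
      constructor
      · rintro ⟨β, hβ, rfl⟩
        rw [heq hβ hβ₀, heq hβ hβ₁, heq hβ hβ₂, h₀, h₁, h₂]
        exact ht β
      · rintro (rfl | rfl | rfl)
        exacts [⟨β₀, hβ₀, rfl⟩, ⟨β₁, hβ₁, rfl⟩, ⟨β₂, hβ₂, rfl⟩]
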